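/- Let X₁,…,Xₙ be i.i.d. real random variables with common density f and let φ = φ_G be the standard Gaussian density. Let α ∈ (0,1), β ∈ (0,1-α), M > 0, and consider the level-α test Ψ_α based on spacings of order statistics. Assume n ≥ 3 and 8.25·log(4·log₂(n/2)/α)/n ≤ ∫_M^∞ φ_G(x)dx. Then there exists a positive constant C(α,β,M), depending only on α, β and M, such that if ρ ≥ C(α,β,M)·√(log log n / n), then sup P_f(Ψ_α = 0) ≤ β, the supremum being over all f ∈ F_{1,G}[M] with ε(1-ε)(μ₂-μ₁)² ≥ ρ. -/

import Mathlib

open MeasureTheory Filter Set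

noncomputable section

/-- The measure on `ℝ` with Lebesgue density `f`. -/
def pdfMeasure (f : ℝ → ℝ) : Measure ℝ :=
  MeasureTheory.volume.withDensity (fun x => ENNReal.ofReal (f x))

/-- The joint law of `n` i.i.d. observations with common density `f`. -/
def sampleMeasure (n : ℕ) (f : ℝ → ℝ) : Measure (Fin n → ℝ) :=
  Measure.pi (fun _ : Fin n => pdfMeasure f)

/-- The `k`-th order statistic (for `1 ≤ k ≤ n`) of the sample `ω`. -/
def oStat {n : ℕ} (k : ℕ) (ω : Fin n → ℝ) : ℝ :=
  if h : 1 ≤ k ∧ k ≤ n then ω (Tuple.sort ω ⟨k - 1, by omega⟩) else 0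

/-- The spacing `X_{(n-k+1)} - X_{(k)}` of the order statistics. -/
def spacing {n : ℕ} (k : ℕ) (ω : Fin n → ℝ) : ℝ :=
  oStat (n - k + 1) ω - oStat k ω

/-- `K_n = {2^j : 0 ≤ j ≤ ⌊log₂ (n/2)⌋}`. -/
def Kfin (n : ℕ) : Finset ℕ :=
  (Finset.range (Nat.log 2 (n / 2) + 1)).image (fun j => 2 ^ j)

/-- The `(1-u)`-quantile of the spacing `X_{(n-k+1)} - X_{(k)}` under the null
hypothesis (sample of density `φ`; under `H₀` this law does not depend on the
translation parameter). -/
def spacingQuantile (n : ℕ) (φ : ℝ → ℝ) (u : ℝ) (k : ℕ) : ℝ :=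
  sInf {t : ℝ | sampleMeasure n φ {ω | spacing k ω > t} ≤ ENNReal.ofReal u}

/-- The corrected level `α_n`. -/
def alphaN (n : ℕ) (φ : ℝ → ℝ) (α : ℝ) : ℝ :=
  sSup {u : ℝ | u ∈ Set.Ioo (0:ℝ) 1 ∧
    sampleMeasure n φ {ω | ∃ k ∈ Kfin n, spacing k ω > spacingQuantile n φ u k}
      ≤ ENNReal.ofReal α}

/-- The rejection region of the multiple spacing test `Ψ_α`. -/
def psiReject (n : ℕ) (φ : ℝ → ℝ) (α : ℝ) : Set (Fin n → ℝ) :=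
  {ω | ∃ k ∈ Kfin n, spacing k ω > spacingQuantile n φ (alphaN n φ α) k}

/-- The empirical (unbiased) variance `S_n²`. -/
def varStat {n : ℕ} (ω : Fin n → ℝ) : ℝ :=
  (∑ i, (ω i - (∑ j, ω j) / (n : ℝ)) ^ 2) / ((n : ℝ) - 1)

/-- The `(1-α)`-quantile of `S_n²` under the null hypothesis. -/
def varQuantile (n : ℕ) (φ : ℝ → ℝ) (α : ℝ) : ℝ :=
  sInf {t : ℝ | sampleMeasure n φ {ω | varStat ω > t} ≤ ENNReal.ofReal α}

/-- The standard Gaussian density. -/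
def phiG (x : ℝ) : ℝ := (Real.sqrt (2 * Real.pi))⁻¹ * Real.exp (-x ^ 2 / 2)

/-- A two-component Gaussian mixture density. -/
def mixG (ε μ₁ μ₂ : ℝ) : ℝ → ℝ := fun x => (1 - ε) * phiG (x - μ₁) + ε * phiG (x - μ₂)

/-- Survival function `Φ̄ = 1 - Φ` of the density `φ`. -/
def Phibar (φ : ℝ → ℝ) (u : ℝ) : ℝ := 1 - ∫ x in Set.Iic u, φ x

/-- The standard Laplace density. -/
def phiL (x : ℝ) : ℝ := (1 / 2) * Real.exp (-|x|)

/-- A two-component Laplace mixture density. -/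
def mixL (ε μ₁ μ₂ : ℝ) : ℝ → ℝ := fun x => (1 - ε) * phiL (x - μ₁) + ε * phiL (x - μ₂)

/-- The threshold `ρ(k,n) = k/n + (1 + √(1+2kβ))/(nβ)`. -/
def rhoKn (n k : ℕ) (β : ℝ) : ℝ :=
  ((k : ℝ) / (n : ℝ)) + (1 + Real.sqrt (1 + 2 * (k : ℝ) * β)) / ((n : ℝ) * β)

lemma phiG_pos (x : ℝ) : 0 < phiG x := by
  unfold phiG; positivity

lemma phiG_neg (x : ℝ) : phiG (-x) = phiG x := by
  simp [phiG]

lemma phiG_eq_gaussianPDFReal : phiG = ProbabilityTheory.gaussianPDFReal 0 1 := by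
  ext x; simp [phiG, ProbabilityTheory.gaussianPDFReal]

lemma integrable_phiG : Integrable phiG := by
  rw [phiG_eq_gaussianPDFReal]; exact ProbabilityTheory.integrable_gaussianPDFReal 0 1

lemma integral_phiG : ∫ x, phiG x = 1 := by
  rw [phiG_eq_gaussianPDFReal]
  exact ProbabilityTheory.integral_gaussianPDFReal_eq_one 0 one_ne_zero

lemma continuous_phiG : Continuous phiG := by
  unfold phiG; fun_prop

lemma phiG_le_one (x : ℝ) : phiG x ≤ 1 := by
  unfold phiG
  have h1 : (1 : ℝ) ≤ Real.sqrt (2 * Real.pi) := by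
    rw [Real.one_le_sqrt]; linarith [Real.pi_gt_three]
  have h2 : Real.exp (-x ^ 2 / 2) ≤ 1 := by
    rw [Real.exp_le_one_iff]; nlinarith [sq_nonneg x]
  exact mul_le_one₀ (inv_le_one_of_one_le₀ h1) (Real.exp_pos _).le h2

lemma phiG_anti {x y : ℝ} (hx : 0 ≤ x) (hxy : x ≤ y) : phiG y ≤ phiG x := by
  unfold phiG
  gcongr

lemma hasDerivAt_phiG (x : ℝ) : HasDerivAt phiG (-(x * phiG x)) x := by
  have h : HasDerivAt (fun y : ℝ => -y ^ 2 / 2) (-x) x := by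
    refine (((hasDerivAt_pow 2 x).neg).div_const 2).congr_deriv ?_
    norm_num; ring
  refine ((h.exp).const_mul (Real.sqrt (2 * Real.pi))⁻¹).congr_deriv ?_
  unfold phiG; ring

/-- The survival function of the standard Gaussian distribution. -/
def gaussTail (t : ℝ) : ℝ := ∫ x in Ioi t, phiG x

lemma gaussTail_eq (t : ℝ) : gaussTail t = gaussTail 0 - ∫ x in (0 : ℝ)..t, phiG x := by
  have := intervalIntegral.integral_interval_add_Ioi (f := phiG) (μ := volume) (a := 0) (b := t)
    integrable_phiG.integrableOn integrable_phiG.integrableOn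
  unfold gaussTail; linarith

lemma hasDerivAt_gaussTail (t : ℝ) : HasDerivAt gaussTail (-phiG t) t := by
  have h : HasDerivAt (fun t => ∫ x in (0 : ℝ)..t, phiG x) (phiG t) t :=
    intervalIntegral.integral_hasDerivAt_right (continuous_phiG.intervalIntegrable _ _)
      continuous_phiG.stronglyMeasurable.stronglyMeasurableAtFilter continuous_phiG.continuousAt
  have := h.const_sub (gaussTail 0)
  rwa [← funext gaussTail_eq] at this

lemma continuous_gaussTail : Continuous gaussTail :=
  continuous_iff_continuousAt.2 fun t => (hasDerivAt_gaussTail t).continuousAt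

lemma gaussTail_pos (t : ℝ) : 0 < gaussTail t := by
  unfold gaussTail
  rw [setIntegral_pos_iff_support_of_nonneg_ae (Eventually.of_forall fun x => (phiG_pos x).le)
    integrable_phiG.integrableOn]
  have : Function.support phiG = univ := by
    ext x; simp [(phiG_pos x).ne']
  simp [this]

lemma tendsto_gaussTail_atTop : Tendsto gaussTail atTop (nhds 0) := by
  have h := intervalIntegral_tendsto_integral_Ioi 0 (integrable_phiG.integrableOn (s := Ioi 0))
    tendsto_id
  have h2 := h.const_sub (gaussTail 0)
  change Tendsto _ _ (nhds (gaussTail 0 - gaussTail 0)) at h2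
  rw [sub_self] at h2
  refine h2.congr fun t => ?_
  rw [gaussTail_eq t]; rfl

lemma integral_Iic_phiG (t : ℝ) : ∫ x in Iic t, phiG x = gaussTail (-t) := by
  rw [gaussTail, ← integral_comp_neg_Iic]
  simp [phiG_neg]

lemma gaussTail_antitone : Antitone gaussTail :=
  antitone_of_hasDerivAt_nonpos hasDerivAt_gaussTail fun x => neg_nonpos.2 (phiG_pos x).le

lemma gaussTail_le_half {t : ℝ} (ht : 0 ≤ t) : gaussTail t ≤ 1 / 2 := by
  have h0 : gaussTail 0 + gaussTail 0 = 1 := by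
    have h1 := integral_Iic_phiG 0
    have h2 := intervalIntegral.integral_Iic_add_Ioi (f := phiG) (μ := volume) (b := 0)
      integrable_phiG.integrableOn integrable_phiG.integrableOn
    rw [integral_phiG, h1, neg_zero] at h2
    exact h2
  linarith [gaussTail_antitone ht]

lemma gaussTail_add_ge {t δ : ℝ} (hδ : 0 ≤ δ) : gaussTail t - δ ≤ gaussTail (t + δ) := by
  have h : Monotone fun x => gaussTail x + x :=
    monotone_of_hasDerivAt_nonneg (fun x => (hasDerivAt_gaussTail x).add (hasDerivAt_id x))
      fun x => by simpa using phiG_le_one x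
  have := h (by linarith : t ≤ t + δ)
  simp only at this
  linarith

lemma gaussTail_add_le {t δ b : ℝ} (ht : 0 ≤ t) (hδ : 0 ≤ δ) (hb : t + δ ≤ b) :
    gaussTail (t + δ) ≤ gaussTail t - phiG b * δ := by
  have h : AntitoneOn (fun x => gaussTail x + phiG b * x) (Icc t (t + δ)) := by
    refine antitoneOn_of_hasDerivWithinAt_nonpos (convex_Icc _ _)
      (by have := continuous_gaussTail; fun_prop)
      (fun x _ => ((hasDerivAt_gaussTail x).add
        ((hasDerivAt_id x).const_mul (phiG b))).hasDerivWithinAt) ?_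
    intro x hx
    rw [interior_Icc] at hx
    have := phiG_anti (by linarith [hx.1] : 0 ≤ x) (by linarith [hx.2] : x ≤ b)
    simp only [mul_one]; linarith
  have := h (left_mem_Icc.2 (by linarith)) (right_mem_Icc.2 (by linarith))
    (by linarith : t ≤ t + δ)
  simp only at this
  linarith

/-- Strong convexity of the Gaussian survival function away from the origin. -/
lemma gaussTail_strong_convex {s a b ε B : ℝ} (hε : ε ∈ Icc (0 : ℝ) 1)
    (hab : (1 - ε) * a + ε * b = 0)
    (ha : 1 ≤ s + a) (hb : 1 ≤ s + b) (ha' : s + a ≤ B) (hb' : s + b ≤ B) :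
    gaussTail s + phiG B / 2 * ((1 - ε) * a ^ 2 + ε * b ^ 2)
      ≤ (1 - ε) * gaussTail (s + a) + ε * gaussTail (s + b) := by
  have h : ConvexOn ℝ (Icc 1 B) (fun x => gaussTail x - phiG B / 2 * x ^ 2) := by
    refine convexOn_of_hasDerivWithinAt2_nonneg (convex_Icc _ _)
      (by have := continuous_gaussTail; fun_prop)
      (f' := fun x => -phiG x - phiG B * x) (f'' := fun x => x * phiG x - phiG B) ?_ ?_ ?_
    · intro x _
      have := (hasDerivAt_gaussTail x).sub ((hasDerivAt_pow 2 x).const_mul (phiG B / 2))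
      refine (this.congr_deriv ?_).hasDerivWithinAt
      norm_num; ring
    · intro x _
      have := (hasDerivAt_phiG x).neg.sub ((hasDerivAt_id x).const_mul (phiG B))
      refine (this.congr_deriv ?_).hasDerivWithinAt
      simp
    · intro x hx
      rw [interior_Icc] at hx
      have h1 := phiG_anti (by linarith [hx.1] : 0 ≤ x) hx.2.le
      nlinarith [hx.1, phiG_pos x]
  have := h.2 ⟨ha, ha'⟩ ⟨hb, hb'⟩ (sub_nonneg.2 hε.2) hε.1 (by ring)
  simp only [smul_eq_mul] at this
  have e : (1 - ε) * (s + a) + ε * (s + b) = s := by linear_combination hab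
  rw [e] at this
  have e2 : (1 - ε) * (s + a) ^ 2 + ε * (s + b) ^ 2
      = s ^ 2 + ((1 - ε) * a ^ 2 + ε * b ^ 2) := by
    linear_combination (2 * s) * hab
  linear_combination this - phiG B / 2 * e2

lemma mixG_nonneg {ε μ₁ μ₂ : ℝ} (hε : ε ∈ Icc (0 : ℝ) 1) (x : ℝ) : 0 ≤ mixG ε μ₁ μ₂ x :=
  add_nonneg (mul_nonneg (sub_nonneg.2 hε.2) (phiG_pos _).le) (mul_nonneg hε.1 (phiG_pos _).le)

lemma integrable_mixG (ε μ₁ μ₂ : ℝ) : Integrable (mixG ε μ₁ μ₂) :=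
  ((integrable_phiG.comp_sub_right μ₁).const_mul _).add
    ((integrable_phiG.comp_sub_right μ₂).const_mul _)

lemma mixG_zero_zero (ε : ℝ) : mixG ε 0 0 = phiG := by
  ext x; simp [mixG]; ring

lemma setIntegral_mixG (ε μ₁ μ₂ : ℝ) (A : Set ℝ) :
    ∫ x in A, mixG ε μ₁ μ₂ x
      = (1 - ε) * (∫ x in A, phiG (x - μ₁)) + ε * ∫ x in A, phiG (x - μ₂) := by
  unfold mixG
  rw [integral_add ((integrable_phiG.comp_sub_right μ₁).const_mul _).integrableOn
    ((integrable_phiG.comp_sub_right μ₂).const_mul _).integrableOn, integral_const_mul,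
    integral_const_mul]

lemma setIntegral_Ioi_phiG_sub (t m : ℝ) : ∫ x in Ioi t, phiG (x - m) = gaussTail (t - m) := by
  rw [gaussTail, ← integral_indicator measurableSet_Ioi, ← integral_indicator measurableSet_Ioi,
    ← integral_sub_right_eq_self ((Ioi (t - m)).indicator phiG) m]
  congr 1; ext x
  simp [indicator]

lemma setIntegral_Iio_phiG_sub (t m : ℝ) : ∫ x in Iio t, phiG (x - m) = gaussTail (m - t) := by
  rw [← integral_Iic_eq_integral_Iio, ← neg_sub_neg, ← setIntegral_Ioi_phiG_sub,
    ← integral_comp_neg_Iic]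
  congr 1; ext x
  rw [← phiG_neg]; congr 1; ring

lemma pdfMeasure_mixG_real {ε μ₁ μ₂ : ℝ} (hε : ε ∈ Icc (0 : ℝ) 1) {A : Set ℝ}
    (hA : MeasurableSet A) :
    (pdfMeasure (mixG ε μ₁ μ₂)).real A = ∫ x in A, mixG ε μ₁ μ₂ x := by
  rw [Measure.real, pdfMeasure, withDensity_apply _ hA, ← ofReal_integral_eq_lintegral_ofReal
    (integrable_mixG _ _ _).integrableOn (Eventually.of_forall (mixG_nonneg hε)),
    ENNReal.toReal_ofReal (integral_nonneg (mixG_nonneg hε))]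

lemma isProbabilityMeasure_pdfMeasure_mixG {ε μ₁ μ₂ : ℝ} (hε : ε ∈ Icc (0 : ℝ) 1) :
    IsProbabilityMeasure (pdfMeasure (mixG ε μ₁ μ₂)) := by
  constructor
  rw [pdfMeasure, withDensity_apply _ MeasurableSet.univ, ← ofReal_integral_eq_lintegral_ofReal
    (integrable_mixG _ _ _).integrableOn (Eventually.of_forall (mixG_nonneg hε)),
    setIntegral_mixG]
  simp [integral_sub_right_eq_self phiG, integral_phiG]

lemma pdfMeasure_mixG_real_Ioi {ε μ₁ μ₂ : ℝ} (hε : ε ∈ Icc (0 : ℝ) 1) (t : ℝ) :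
    (pdfMeasure (mixG ε μ₁ μ₂)).real (Ioi t)
      = (1 - ε) * gaussTail (t - μ₁) + ε * gaussTail (t - μ₂) := by
  rw [pdfMeasure_mixG_real hε measurableSet_Ioi, setIntegral_mixG, setIntegral_Ioi_phiG_sub,
    setIntegral_Ioi_phiG_sub]

lemma pdfMeasure_mixG_real_Iio {ε μ₁ μ₂ : ℝ} (hε : ε ∈ Icc (0 : ℝ) 1) (t : ℝ) :
    (pdfMeasure (mixG ε μ₁ μ₂)).real (Iio t)
      = (1 - ε) * gaussTail (μ₁ - t) + ε * gaussTail (μ₂ - t) := by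
  rw [pdfMeasure_mixG_real hε measurableSet_Iio, setIntegral_mixG, setIntegral_Iio_phiG_sub,
    setIntegral_Iio_phiG_sub]

/-- Hoeffding's upper tail bound for the number of observations falling in a set. -/
lemma card_ge_le_exp (ν : Measure ℝ) [IsProbabilityMeasure ν] {n : ℕ} (hn : 0 < n) {A : Set ℝ}
    [DecidablePred (· ∈ A)] (hA : MeasurableSet A) {x : ℝ} (hx : 0 ≤ x) :
    Measure.pi (fun _ : Fin n => ν)
      {ω | n * (ν.real A + x) ≤ ((Finset.univ.filter fun i => ω i ∈ A).card : ℝ)}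
      ≤ ENNReal.ofReal (Real.exp (-(2 * n * x ^ 2))) := by
  set g : ℝ → ℝ := A.indicator 1 with hg
  have hgm : Measurable g := measurable_one.indicator hA
  have hint : ∫ y, g y ∂ν = ν.real A := by
    rw [hg, integral_indicator_one hA]
  have hsub : ∀ i : Fin n, ProbabilityTheory.HasSubgaussianMGF
      (fun ω : Fin n → ℝ => g (ω i) - ν.real A) ((‖(1 : ℝ) - 0‖₊ / 2) ^ 2)
      (Measure.pi (fun _ : Fin n => ν)) := by
    intro i
    have h := ProbabilityTheory.hasSubgaussianMGF_of_mem_Icc (a := 0) (b := 1)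
      (μ := Measure.pi (fun _ : Fin n => ν)) (X := fun ω => g (ω i))
      (hgm.comp (measurable_pi_apply i)).aemeasurable
      (Eventually.of_forall fun ω => by
        by_cases h : ω i ∈ A <;> simp [hg, h])
    have e : ∫ ω : Fin n → ℝ, g (ω i) ∂(Measure.pi (fun _ : Fin n => ν)) = ν.real A := by
      have h2 := integral_map (μ := Measure.pi (fun _ : Fin n => ν))
        (measurable_pi_apply i).aemeasurable hgm.aestronglyMeasurable
      rw [← h2, ← hint, (measurePreserving_eval (fun _ : Fin n => ν) i).map_eq]
    rwa [e] at h
  have hind : ProbabilityTheory.iIndepFun (fun (i : Fin n) (ω : Fin n → ℝ) => g (ω i) - ν.real A)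
      (Measure.pi (fun _ : Fin n => ν)) :=
    ProbabilityTheory.iIndepFun_pi (X := fun _ y => g y - ν.real A)
      fun _ => (hgm.sub_const _).aemeasurable
  have key := ProbabilityTheory.HasSubgaussianMGF.measure_sum_ge_le_of_iIndepFun hind
    (s := Finset.univ) (fun i _ => hsub i) (ε := n * x) (by positivity)
  rw [← ofReal_measureReal]
  refine ENNReal.ofReal_le_ofReal ?_
  convert key using 3
  · ext ω
    have : ∑ i, (g (ω i) - ν.real A)
        = ((Finset.univ.filter fun i => ω i ∈ A).card : ℝ) - n * ν.real A := by
      simp [hg, Finset.sum_sub_distrib, indicator_apply]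
    rw [this]
    constructor <;> intro h <;> linarith
  · have : (n : ℝ) ≠ 0 := by positivity
    simp
    field_simp

/-- Hoeffding's lower tail bound for the number of observations falling in a set. -/
lemma card_le_le_exp (ν : Measure ℝ) [IsProbabilityMeasure ν] {n : ℕ} (hn : 0 < n) {A : Set ℝ}
    [DecidablePred (· ∈ A)] (hA : MeasurableSet A) {x : ℝ} (hx : 0 ≤ x) :
    Measure.pi (fun _ : Fin n => ν)
      {ω | ((Finset.univ.filter fun i => ω i ∈ A).card : ℝ) ≤ n * (ν.real A - x)}
      ≤ ENNReal.ofReal (Real.exp (-(2 * n * x ^ 2))) := by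
  refine (measure_mono fun ω hω => ?_).trans (card_ge_le_exp ν hn hA.compl hx)
  have h := Finset.card_filter_add_card_filter_not (s := (Finset.univ : Finset (Fin n)))
    (fun i => ω i ∈ A)
  rw [Finset.card_univ, Fintype.card_fin] at h
  have h' : ((Finset.univ.filter fun i => ω i ∈ A).card : ℝ)
    + ((Finset.univ.filter fun i => ω i ∉ A).card : ℝ) = n := by exact_mod_cast h
  simp only [mem_ofPred_eq, mem_compl_iff] at hω ⊢
  rw [probReal_compl_eq_one_sub hA]
  linarith

lemma card_filter_comp_sort {n : ℕ} (ω : Fin n → ℝ) (p : ℝ → Prop) [DecidablePred p] :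
    (Finset.univ.filter fun i => p (ω i)).card
      = (Finset.univ.filter fun i => p (ω (Tuple.sort ω i))).card := by
  rw [← Finset.card_map (Tuple.sort ω).toEmbedding
    (s := Finset.univ.filter fun i => p (ω (Tuple.sort ω i)))]
  congr 1; ext i
  simp only [Finset.mem_filter, Finset.mem_univ, true_and, Finset.mem_map, Equiv.coe_toEmbedding]
  constructor
  · intro h; exact ⟨(Tuple.sort ω).symm i, by simpa using h, by simp⟩
  · rintro ⟨j, hj, rfl⟩; exact hj

lemma lt_oStat_iff {n k : ℕ} (hk : 1 ≤ k) (hkn : k ≤ n) (ω : Fin n → ℝ) (s : ℝ) :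
    s < oStat (n - k + 1) ω ↔ k ≤ (Finset.univ.filter fun i => ω i ∈ Ioi s).card := by
  have hmono : Monotone (ω ∘ Tuple.sort ω) := Tuple.monotone_sort ω
  have hlt : n - k < n := by omega
  have e : oStat (n - k + 1) ω = ω (Tuple.sort ω ⟨n - k, hlt⟩) := by
    rw [oStat, dif_pos ⟨by omega, by omega⟩]; rfl
  rw [e, card_filter_comp_sort ω (· ∈ Ioi s)]
  constructor
  · intro h
    have : (Finset.Ici (⟨n - k, hlt⟩ : Fin n)) ⊆
        Finset.univ.filter fun i => ω (Tuple.sort ω i) ∈ Ioi s := by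
      intro i hi
      simp only [Finset.mem_filter, Finset.mem_univ, true_and, mem_Ioi]
      exact h.trans_le (hmono (Finset.mem_Ici.1 hi))
    have h2 := Finset.card_le_card this
    rw [Fin.card_Ici] at h2
    simp only at h2; omega
  · intro h
    by_contra hc
    have : (Finset.univ.filter fun i => ω (Tuple.sort ω i) ∈ Ioi s) ⊆
        Finset.Ioi (⟨n - k, hlt⟩ : Fin n) := by
      intro i hi
      simp only [Finset.mem_filter, Finset.mem_univ, true_and, mem_Ioi] at hi
      rw [Finset.mem_Ioi]
      by_contra h3
      exact hc (hi.trans_le (hmono (not_lt.1 h3)))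
    have h2 := Finset.card_le_card this
    rw [Fin.card_Ioi] at h2
    simp only at h2; omega

lemma oStat_lt_iff {n k : ℕ} (hk : 1 ≤ k) (hkn : k ≤ n) (ω : Fin n → ℝ) (s : ℝ) :
    oStat k ω < s ↔ k ≤ (Finset.univ.filter fun i => ω i ∈ Iio s).card := by
  have hmono : Monotone (ω ∘ Tuple.sort ω) := Tuple.monotone_sort ω
  have hlt : k - 1 < n := by omega
  have e : oStat k ω = ω (Tuple.sort ω ⟨k - 1, hlt⟩) := by
    rw [oStat, dif_pos ⟨by omega, by omega⟩]
  rw [e, card_filter_comp_sort ω (· ∈ Iio s)]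
  constructor
  · intro h
    have : (Finset.Iic (⟨k - 1, hlt⟩ : Fin n)) ⊆
        Finset.univ.filter fun i => ω (Tuple.sort ω i) ∈ Iio s := by
      intro i hi
      simp only [Finset.mem_filter, Finset.mem_univ, true_and, mem_Iio]
      exact (hmono (Finset.mem_Iic.1 hi)).trans_lt h
    have h2 := Finset.card_le_card this
    rw [Fin.card_Iic] at h2
    simp only at h2; omega
  · intro h
    by_contra hc
    have : (Finset.univ.filter fun i => ω (Tuple.sort ω i) ∈ Iio s) ⊆
        Finset.Iio (⟨k - 1, hlt⟩ : Fin n) := by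
      intro i hi
      simp only [Finset.mem_filter, Finset.mem_univ, true_and, mem_Iio] at hi
      rw [Finset.mem_Iio]
      by_contra h3
      exact hc ((hmono (not_lt.1 h3)).trans_lt hi)
    have h2 := Finset.card_le_card this
    rw [Fin.card_Iio] at h2
    simp only at h2; omega

lemma abs_oStat_le {n : ℕ} (k : ℕ) (ω : Fin n → ℝ) : |oStat k ω| ≤ ‖ω‖ := by
  unfold oStat
  split_ifs with h
  · exact norm_le_pi_norm ω _
  · simp

lemma mem_Kfin_le {n k : ℕ} (hn : 2 ≤ n) (hk : k ∈ Kfin n) : 1 ≤ k ∧ k ≤ n / 2 := by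
  simp only [Kfin, Finset.mem_image, Finset.mem_range] at hk
  obtain ⟨j, hj, rfl⟩ := hk
  exact ⟨Nat.one_le_two_pow, Nat.pow_le_of_le_log (by omega) (by omega)⟩

/-- The spacing exceeds its `(1-u)`-quantile with probability at most `u`. -/
lemma sampleMeasure_spacing_gt_quantile_le {n k : ℕ} {φ : ℝ → ℝ}
    [IsProbabilityMeasure (sampleMeasure n φ)] {u : ℝ} (hu : u ∈ Ioo (0 : ℝ) 1) :
    sampleMeasure n φ {ω | spacing k ω > spacingQuantile n φ u k} ≤ ENNReal.ofReal u := by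
  set P := sampleMeasure n φ
  set S : Set ℝ := {t : ℝ | P {ω | spacing k ω > t} ≤ ENNReal.ofReal u} with hS
  have hne : S.Nonempty := by
    have hlim : Tendsto (fun N : ℕ => P {ω : Fin n → ℝ | (N : ℝ) < 2 * ‖ω‖}) atTop
        (nhds (P (⋂ N : ℕ, {ω : Fin n → ℝ | (N : ℝ) < 2 * ‖ω‖}))) := by
      refine tendsto_measure_iInter_atTop
        (fun N => (measurableSet_lt measurable_const (by fun_prop)).nullMeasurableSet) ?_
        ⟨0, measure_ne_top _ _⟩
      intro N N' h ω hω
      have hω' : (N' : ℝ) < 2 * ‖ω‖ := hω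
      have : (N : ℝ) ≤ N' := by exact_mod_cast h
      exact this.trans_lt hω'
    have hempty : (⋂ N : ℕ, {ω : Fin n → ℝ | (N : ℝ) < 2 * ‖ω‖}) = ∅ := by
      ext ω
      obtain ⟨N, hN⟩ := exists_nat_ge (2 * ‖ω‖)
      simp only [mem_iInter, mem_ofPred_eq, mem_empty_iff_false, iff_false, not_forall, not_lt]
      exact ⟨N, hN⟩
    rw [hempty, measure_empty] at hlim
    obtain ⟨N, hN⟩ := (hlim.eventually (gt_mem_nhds (ENNReal.ofReal_pos.2 hu.1))).exists
    refine ⟨N, (measure_mono fun ω hω => ?_).trans hN.le⟩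
    have h1 := abs_le.1 (abs_oStat_le (n - k + 1) ω)
    have h2 := abs_le.1 (abs_oStat_le k ω)
    simp only [mem_ofPred_eq, spacing] at hω ⊢
    linarith [h1.2, h2.1]
  have hq : {ω : Fin n → ℝ | spacing k ω > sInf S}
      = ⋃ m : ℕ, {ω | spacing k ω > sInf S + 1 / ((m : ℝ) + 1)} := by
    ext ω
    simp only [mem_ofPred_eq, mem_iUnion]
    constructor
    · intro h
      obtain ⟨m, hm⟩ := exists_nat_one_div_lt (sub_pos.2 h)
      exact ⟨m, by linarith⟩
    · rintro ⟨m, hm⟩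
      have : 0 < 1 / ((m : ℝ) + 1) := by positivity
      linarith
  change P {ω : Fin n → ℝ | spacing k ω > sInf S} ≤ _
  have hmon : Monotone fun m : ℕ => {ω : Fin n → ℝ | spacing k ω > sInf S + 1 / ((m : ℝ) + 1)} := by
    intro m m' h ω hω
    have := Nat.one_div_le_one_div (α := ℝ) h
    simp only [mem_ofPred_eq] at hω ⊢
    linarith
  rw [hq]
  refine le_of_tendsto' (tendsto_measure_iUnion_atTop hmon) fun m => ?_
  have hpos : 0 < 1 / ((m : ℝ) + 1) := by positivity
  obtain ⟨t, ht, htlt⟩ := exists_lt_of_csInf_lt hne (lt_add_of_pos_right (sInf S) hpos)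
  refine (measure_mono fun ω hω => ?_).trans ht
  exact lt_trans htlt hω

lemma spacingQuantile_le {n k : ℕ} {φ : ℝ → ℝ} {u t : ℝ} (ht : 0 ≤ t)
    (h : sampleMeasure n φ {ω | spacing k ω > t} ≤ ENNReal.ofReal u) :
    spacingQuantile n φ u k ≤ t := by
  unfold spacingQuantile
  by_cases hb : BddBelow {t : ℝ | sampleMeasure n φ {ω | spacing k ω > t} ≤ ENNReal.ofReal u}
  · exact csInf_le hb h
  · rwa [Real.sInf_of_not_bddBelow hb]

/-- Union bound: the corrected level is at least the Bonferroni level. -/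
lemma div_card_le_alphaN {n : ℕ} {φ : ℝ → ℝ}
    [IsProbabilityMeasure (sampleMeasure n φ)] {α : ℝ} (hα : α ∈ Ioo (0 : ℝ) 1) :
    α / (Kfin n).card ≤ alphaN n φ α := by
  have hc : 1 ≤ (Kfin n).card := by
    refine Finset.card_pos.2 ⟨2 ^ 0, ?_⟩
    exact Finset.mem_image_of_mem _ (by simp)
  have hc' : (1 : ℝ) ≤ (Kfin n).card := by exact_mod_cast hc
  have hu : α / (Kfin n).card ∈ Ioo (0 : ℝ) 1 :=
    ⟨div_pos hα.1 (by linarith), (div_le_self hα.1.le hc').trans_lt hα.2⟩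
  refine le_csSup ⟨1, fun u hu => hu.1.2.le⟩ ⟨hu, ?_⟩
  have : {ω : Fin n → ℝ | ∃ k ∈ Kfin n, spacing k ω > spacingQuantile n φ (α / (Kfin n).card) k}
      = ⋃ k ∈ Kfin n, {ω | spacing k ω > spacingQuantile n φ (α / (Kfin n).card) k} := by
    ext ω; simp
  rw [this]
  refine (measure_biUnion_finset_le _ _).trans ?_
  refine (Finset.sum_le_card_nsmul _ _ (ENNReal.ofReal (α / (Kfin n).card)) fun k _ =>
    sampleMeasure_spacing_gt_quantile_le hu).trans ?_
  rw [← ENNReal.ofReal_nsmul, nsmul_eq_mul, mul_div_cancel₀ _ (by linarith)]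

lemma isProbabilityMeasure_sampleMeasure_mixG (n : ℕ) {ε μ₁ μ₂ : ℝ} (hε : ε ∈ Icc (0 : ℝ) 1) :
    IsProbabilityMeasure (sampleMeasure n (mixG ε μ₁ μ₂)) := by
  have := isProbabilityMeasure_pdfMeasure_mixG (μ₁ := μ₁) (μ₂ := μ₂) hε
  unfold sampleMeasure; infer_instance

/-- Upper deviation bound for the spacing under the null hypothesis. -/
lemma sampleMeasure_phiG_spacing_gt_le {n k : ℕ} (hk : 1 ≤ k) (hkn : k ≤ n) {s x : ℝ}
    (hx : 0 ≤ x) (hs : n * (gaussTail s + x) ≤ k) :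
    sampleMeasure n phiG {ω | spacing k ω > 2 * s}
      ≤ ENNReal.ofReal (2 * Real.exp (-(2 * n * x ^ 2))) := by
  classical
  have h01 : (0 : ℝ) ∈ Icc (0 : ℝ) 1 := ⟨le_rfl, zero_le_one⟩
  rw [← mixG_zero_zero 0]
  have := isProbabilityMeasure_pdfMeasure_mixG (μ₁ := 0) (μ₂ := 0) h01
  have hn : 0 < n := by omega
  have hA := card_ge_le_exp (pdfMeasure (mixG 0 0 0)) hn (measurableSet_Ioi (a := s)) hx
  have hB := card_ge_le_exp (pdfMeasure (mixG 0 0 0)) hn (measurableSet_Iio (a := -s)) hx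
  rw [pdfMeasure_mixG_real_Ioi h01] at hA
  rw [pdfMeasure_mixG_real_Iio h01] at hB
  rw [two_mul (Real.exp _), ENNReal.ofReal_add (Real.exp_pos _).le (Real.exp_pos _).le]
  refine le_trans ((measure_mono fun ω hω => ?_).trans (measure_union_le _ _)) (add_le_add hA hB)
  simp only [mem_union, mem_ofPred_eq, sub_zero, zero_sub, neg_neg, zero_mul, add_zero,
    one_mul] at hω ⊢
  by_cases h : s < oStat (n - k + 1) ω
  · left
    exact hs.trans (by exact_mod_cast (lt_oStat_iff hk hkn ω s).1 h)
  · right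
    have h2 : oStat k ω < -s := by
      unfold spacing at hω; linarith
    exact hs.trans (by exact_mod_cast (oStat_lt_iff hk hkn ω (-s)).1 h2)

/-- Lower deviation bound for the spacing under a two-component mixture. -/
lemma sampleMeasure_mixG_spacing_le_le {n k : ℕ} (hk : 1 ≤ k) (hkn : k ≤ n) {ε μ₁ μ₂ s x B : ℝ}
    (hε : ε ∈ Icc (0 : ℝ) 1) (hμ : μ₁ ≤ μ₂) (hx : 0 ≤ x)
    (hs : 1 ≤ s - (μ₂ - μ₁)) (hB : s + (μ₂ - μ₁) ≤ B)
    (hks : k ≤ n * (gaussTail s + phiG B / 2 * (ε * (1 - ε) * (μ₂ - μ₁) ^ 2) - x)) :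
    sampleMeasure n (mixG ε μ₁ μ₂) {ω | spacing k ω ≤ 2 * s}
      ≤ ENNReal.ofReal (2 * Real.exp (-(2 * n * x ^ 2))) := by
  classical
  have := isProbabilityMeasure_pdfMeasure_mixG (μ₁ := μ₁) (μ₂ := μ₂) hε
  have hn : 0 < n := by omega
  have hn' : (0 : ℝ) ≤ n := by positivity
  set m := (1 - ε) * μ₁ + ε * μ₂ with hm
  have hA := card_le_le_exp (pdfMeasure (mixG ε μ₁ μ₂)) hn (measurableSet_Ioi (a := s + m)) hx
  have hB' := card_le_le_exp (pdfMeasure (mixG ε μ₁ μ₂)) hn (measurableSet_Iio (a := m - s)) hx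
  rw [pdfMeasure_mixG_real_Ioi hε] at hA
  rw [pdfMeasure_mixG_real_Iio hε] at hB'
  have d0 : 0 ≤ μ₂ - μ₁ := sub_nonneg.2 hμ
  have d1 : 0 ≤ ε * (μ₂ - μ₁) := mul_nonneg hε.1 d0
  have d2 : 0 ≤ (1 - ε) * (μ₂ - μ₁) := mul_nonneg (sub_nonneg.2 hε.2) d0
  have c1 := gaussTail_strong_convex (s := s) (a := m - μ₁) (b := m - μ₂) (B := B) hε
    (by rw [hm]; ring) (by rw [hm]; linarith) (by rw [hm]; linarith) (by rw [hm]; linarith)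
    (by rw [hm]; linarith)
  have c2 := gaussTail_strong_convex (s := s) (a := μ₁ - m) (b := μ₂ - m) (B := B) hε
    (by rw [hm]; ring) (by rw [hm]; linarith) (by rw [hm]; linarith) (by rw [hm]; linarith)
    (by rw [hm]; linarith)
  have q1 : (1 - ε) * (m - μ₁) ^ 2 + ε * (m - μ₂) ^ 2 = ε * (1 - ε) * (μ₂ - μ₁) ^ 2 := by
    rw [hm]; ring
  have q2 : (1 - ε) * (μ₁ - m) ^ 2 + ε * (μ₂ - m) ^ 2 = ε * (1 - ε) * (μ₂ - μ₁) ^ 2 := by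
    rw [hm]; ring
  rw [q1] at c1
  rw [q2] at c2
  rw [two_mul (Real.exp _), ENNReal.ofReal_add (Real.exp_pos _).le (Real.exp_pos _).le]
  refine le_trans ((measure_mono fun ω hω => ?_).trans (measure_union_le _ _)) (add_le_add hA hB')
  simp only [mem_union, mem_ofPred_eq] at hω ⊢
  rw [show s + m - μ₁ = s + (m - μ₁) by ring, show s + m - μ₂ = s + (m - μ₂) by ring,
    show μ₁ - (m - s) = s + (μ₁ - m) by ring, show μ₂ - (m - s) = s + (μ₂ - m) by ring]
  by_cases h : s + m < oStat (n - k + 1) ω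
  · right
    have h2 : ¬ oStat k ω < m - s := by
      unfold spacing at hω; intro h3; linarith
    rw [oStat_lt_iff hk hkn, not_le] at h2
    refine (Nat.cast_le.2 h2.le).trans (hks.trans ?_)
    gcongr
  · left
    rw [lt_oStat_iff hk hkn, not_le] at h
    refine (Nat.cast_le.2 h.le).trans (hks.trans ?_)
    gcongr

lemma card_Kfin_le {n : ℕ} (hn : 2 ≤ n) : ((Kfin n).card : ℝ) ≤ 2 * Real.log n := by
  have h1 : (Kfin n).card ≤ Nat.log 2 n := by
    refine (Finset.card_image_le).trans ?_
    rw [Finset.card_range, Nat.log_div_base]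
    have : 1 ≤ Nat.log 2 n := Nat.log_pos (by norm_num) hn
    omega
  have h2 : ((2 ^ Nat.log 2 n : ℕ) : ℝ) ≤ n := by
    exact_mod_cast Nat.pow_log_le_self 2 (by omega)
  have h3 := Real.log_le_log (by positivity) h2
  push_cast at h3
  rw [Real.log_pow] at h3
  have h4 := Real.log_two_gt_d9
  have h5 : ((Kfin n).card : ℝ) ≤ Nat.log 2 n := by exact_mod_cast h1
  have h6 : (0 : ℝ) ≤ Nat.log 2 n := by positivity
  nlinarith

/-- A dyadic index whose relative size lies within a factor two of a given level. -/
lemma exists_mem_Kfin {n : ℕ} {a : ℝ} (ha : a ≤ 1 / 2) (hna : 1 ≤ n * a) :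
    ∃ k ∈ Kfin n, (k : ℝ) ≤ n * a ∧ n * a ≤ 2 * k := by
  have h1 : 1 ≤ ⌊n * a⌋₊ := Nat.le_floor (by simpa using hna)
  have hfl : (⌊n * a⌋₊ : ℝ) ≤ n * a := Nat.floor_le (by linarith)
  have hpow : 2 ^ Nat.log 2 ⌊n * a⌋₊ ≤ ⌊n * a⌋₊ := Nat.pow_log_le_self 2 (by omega)
  have hhalf : ⌊n * a⌋₊ ≤ n / 2 := by
    rw [Nat.le_div_iff_mul_le (by norm_num)]
    have : (⌊n * a⌋₊ : ℝ) * 2 ≤ n := by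
      have : (0 : ℝ) ≤ n := by positivity
      nlinarith
    exact_mod_cast this
  refine ⟨2 ^ Nat.log 2 ⌊n * a⌋₊, Finset.mem_image_of_mem _ (Finset.mem_range.2
    (Nat.lt_succ_of_le (Nat.log_mono_right hhalf))), ?_, ?_⟩
  · exact le_trans (by exact_mod_cast hpow) hfl
  · have h2 : ⌊n * a⌋₊ < 2 ^ (Nat.log 2 ⌊n * a⌋₊ + 1) := Nat.lt_pow_succ_log_self (by norm_num) _
    have h3 : n * a < ((2 ^ (Nat.log 2 ⌊n * a⌋₊ + 1) : ℕ) : ℝ) := (Nat.floor_lt (by linarith)).1 h2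
    rw [pow_succ] at h3
    push_cast at h3 ⊢
    linarith

/-- If the iterated-logarithm rate is small then the sample size is large. -/
lemma exists_sample_size_lower_bound (N : ℕ) :
    ∃ r : ℝ, 0 < r ∧ ∀ n : ℕ, 3 ≤ n →
      Real.sqrt (Real.log (Real.log n) / n) < r → N ≤ n := by
  have h3 : 0 < Real.log (Real.log 3) := by
    refine Real.log_pos ?_
    rw [Real.lt_log_iff_exp_lt (by norm_num)]
    exact Real.exp_one_lt_three
  refine ⟨Real.sqrt (Real.log (Real.log 3) / (N + 1)), Real.sqrt_pos.2 (by positivity), ?_⟩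
  intro n hn h
  by_contra hc
  refine absurd h (not_lt.2 (Real.sqrt_le_sqrt ?_))
  have hn' : (3 : ℝ) ≤ n := by exact_mod_cast hn
  have hN : (n : ℝ) ≤ N + 1 := by
    have : n ≤ N + 1 := by omega
    exact_mod_cast this
  have hl3 : 0 < Real.log 3 := Real.log_pos (by norm_num)
  have : Real.log (Real.log 3) ≤ Real.log (Real.log n) :=
    Real.log_le_log hl3 (Real.log_le_log (by norm_num) hn')
  exact div_le_div₀ (h3.le.trans this) this (by linarith) hN

lemma one_le_log_log {n : ℕ} (hn : 16 ≤ n) : 1 ≤ Real.log (Real.log n) := by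
  have h16 : Real.exp 1 ≤ Real.log 16 := by
    rw [show (16 : ℝ) = 2 ^ 4 by norm_num, Real.log_pow]
    have := Real.log_two_gt_d9
    have := Real.exp_one_lt_d9
    push_cast; linarith
  have hn' : (16 : ℝ) ≤ n := by exact_mod_cast hn
  have h := h16.trans (Real.log_le_log (by norm_num) hn')
  rwa [Real.le_log_iff_exp_le ((Real.exp_pos 1).trans_le h)]

lemma two_mul_exp_le_div_card_Kfin {n : ℕ} (hn : 16 ≤ n) {α : ℝ} (hα : α ∈ Ioo (0 : ℝ) 1) :
    2 * Real.exp (-(2 * (Real.log (4 / α) + 1) ^ 2 * Real.log (Real.log n)))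
      ≤ α / (Kfin n).card := by
  have hα0 := hα.1
  have hL := one_le_log_log hn
  have hlogn : 0 < Real.log n := Real.log_pos (by exact_mod_cast (by omega : 1 < n))
  have hl : 0 < Real.log (4 / α) := Real.log_pos (by rw [lt_div_iff₀ hα0]; linarith [hα.2])
  have hcard : (0 : ℝ) < (Kfin n).card := by
    exact_mod_cast Finset.card_pos.2 ⟨2 ^ 0, Finset.mem_image_of_mem _ (by simp)⟩
  have h2 : Real.log (4 / α) + Real.log (Real.log n)
      ≤ 2 * (Real.log (4 / α) + 1) ^ 2 * Real.log (Real.log n) := by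
    generalize Real.log (4 / α) = l at *
    generalize Real.log (Real.log n) = L at *
    have h3 : l + L ≤ (l + 1) * L := by nlinarith
    have h4 : l + 1 ≤ 2 * (l + 1) ^ 2 := by nlinarith
    exact h3.trans (mul_le_mul_of_nonneg_right h4 (by linarith))
  have h3 : Real.exp (-(2 * (Real.log (4 / α) + 1) ^ 2 * Real.log (Real.log n)))
      ≤ α / 4 / Real.log n := by
    refine (Real.exp_le_exp.2 (neg_le_neg h2)).trans (le_of_eq ?_)
    rw [Real.exp_neg, Real.exp_add, Real.exp_log (by positivity), Real.exp_log hlogn]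
    field_simp
  calc 2 * Real.exp (-(2 * (Real.log (4 / α) + 1) ^ 2 * Real.log (Real.log n)))
      ≤ 2 * (α / 4 / Real.log n) := by gcongr
    _ = α / (2 * Real.log n) := by field_simp; norm_num
    _ ≤ α / (Kfin n).card := by
      have := card_Kfin_le (by omega : 2 ≤ n)
      gcongr

lemma two_mul_exp_le {β L : ℝ} (hβ : β ∈ Ioo (0 : ℝ) 1) (hL : 1 ≤ L) :
    2 * Real.exp (-(2 * (Real.log (2 / β) + 1) ^ 2 * L)) ≤ β := by
  have hβ0 := hβ.1
  have hl : 0 < Real.log (2 / β) := Real.log_pos (by rw [lt_div_iff₀ hβ0]; linarith [hβ.2])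
  have h2 : Real.log (2 / β) ≤ 2 * (Real.log (2 / β) + 1) ^ 2 * L := by
    generalize Real.log (2 / β) = l at *
    have : l ≤ 2 * (l + 1) ^ 2 := by nlinarith
    exact this.trans (le_mul_of_one_le_right (by positivity) hL)
  have h3 : Real.exp (-(2 * (Real.log (2 / β) + 1) ^ 2 * L)) ≤ β / 2 := by
    refine (Real.exp_le_exp.2 (neg_le_neg h2)).trans (le_of_eq ?_)
    rw [Real.exp_neg, Real.exp_log (by positivity), inv_div]
  linarith

lemma mul_one_sub_mul_sq_le {ε d M : ℝ} (hε : ε ∈ Icc (0 : ℝ) 1) (hd : 0 ≤ d) (hdM : d ≤ M) :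
    ε * (1 - ε) * d ^ 2 ≤ M ^ 2 := by
  have h1 : d ^ 2 ≤ M ^ 2 := pow_le_pow_left₀ hd hdM 2
  have h2 : ε * (1 - ε) ≤ 1 := by nlinarith [hε.1, hε.2]
  exact (mul_le_of_le_one_left (sq_nonneg d) h2).trans h1

/-- upper bound for the spacing test `Ψ_α` in the dense Gaussian case
(Theorem `majo`). -/
theorem stmt1 (α β M : ℝ)
    (hα : α ∈ Set.Ioo (0:ℝ) 1) (hβ : β ∈ Set.Ioo (0:ℝ) (1 - α)) (hM : 0 < M) :
    ∃ C : ℝ, 0 < C ∧ ∀ n : ℕ, 3 ≤ n →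
      (8.25 : ℝ) * Real.log (4 * Real.logb 2 ((n : ℝ) / 2) / α) / (n : ℝ)
        ≤ ∫ x in Set.Ioi M, phiG x →
      ∀ ρ : ℝ, C * Real.sqrt (Real.log (Real.log (n : ℝ)) / (n : ℝ)) ≤ ρ →
      ∀ ε μ₁ μ₂ : ℝ, ε ∈ Set.Ioo (0:ℝ) 1 → μ₁ < μ₂ → μ₂ - μ₁ ≤ M →
        ρ ≤ ε * (1 - ε) * (μ₂ - μ₁) ^ 2 →
        sampleMeasure n (mixG ε μ₁ μ₂) (psiReject n phiG α)ᶜ ≤ ENNReal.ofReal β := by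
  have hα0 := hα.1
  have hβ0 := hβ.1
  have ha_pos := gaussTail_pos (M + 1)
  have ha_half := gaussTail_le_half (by linarith : 0 ≤ M + 1)
  set a := gaussTail (M + 1) with ha
  obtain ⟨T, hTa, hTM⟩ := ((tendsto_gaussTail_atTop.eventually
    (ge_mem_nhds (half_pos ha_pos))).and (eventually_ge_atTop (M + 1))).exists
  obtain ⟨r, hr, hrn⟩ := exists_sample_size_lower_bound (max 16 ⌈1 / a⌉₊)
  have hc0 := phiG_pos (T + 1)
  have hc1 := phiG_pos (T + 1 + M)
  set c₀ := phiG (T + 1) with hc₀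
  set c₁ := phiG (T + 1 + M) / 2 with hc₁
  have hc1' : 0 < c₁ := half_pos hc1
  set D := (Real.log (4 / α) + 1) / c₀ with hD
  set E := Real.log (2 / β) + 1 with hE
  have hlogα : 0 < Real.log (4 / α) :=
    Real.log_pos (by rw [lt_div_iff₀ hα0]; linarith [hα.2])
  have hlogβ : 0 < Real.log (2 / β) :=
    Real.log_pos (by rw [lt_div_iff₀ hβ0]; linarith [hβ.2])
  have hDpos : 0 < D := div_pos (by linarith) hc0
  have hM2 : 0 < M ^ 2 := by positivity
  refine ⟨2 * M ^ 2 / r + D * M ^ 2 + (D + E) / c₁, by positivity, ?_⟩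
  intro n hn _ ρ hρ ε μ₁ μ₂ hε hμ hμM hρε
  set C := 2 * M ^ 2 / r + D * M ^ 2 + (D + E) / c₁ with hC
  set x := Real.sqrt (Real.log (Real.log n) / n) with hx
  have hx0 : 0 ≤ x := Real.sqrt_nonneg _
  have hε' : ε ∈ Icc (0 : ℝ) 1 := Ioo_subset_Icc_self hε
  have hup := mul_one_sub_mul_sq_le hε' (by linarith : 0 ≤ μ₂ - μ₁) hμM
  have hCx : C * x ≤ ε * (1 - ε) * (μ₂ - μ₁) ^ 2 := hρ.trans hρε
  have hCx' : C * x ≤ M ^ 2 := hCx.trans hup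
  have hp1 : 0 < 2 * M ^ 2 / r := by positivity
  have hp2 : 0 < D * M ^ 2 := by positivity
  have hp3 : 0 < (D + E) / c₁ := by positivity
  have hxr : x < r := by
    have h1 : 2 * M ^ 2 / r * x ≤ M ^ 2 :=
      (mul_le_mul_of_nonneg_right (by linarith) hx0).trans hCx'
    rw [div_mul_eq_mul_div, div_le_iff₀ hr, mul_comm 2, mul_assoc,
      mul_le_mul_iff_right₀ hM2] at h1
    linarith
  have hDx : D * x ≤ 1 := by
    have h1 : D * M ^ 2 * x ≤ M ^ 2 :=
      (mul_le_mul_of_nonneg_right (by linarith) hx0).trans hCx'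
    rw [mul_right_comm] at h1
    exact (mul_le_iff_le_one_left hM2).1 h1
  have hDE : (D + E) * x ≤ c₁ * (ε * (1 - ε) * (μ₂ - μ₁) ^ 2) := by
    have h1 : (D + E) / c₁ * x ≤ ε * (1 - ε) * (μ₂ - μ₁) ^ 2 :=
      (mul_le_mul_of_nonneg_right (by linarith) hx0).trans hCx
    rw [div_mul_eq_mul_div, div_le_iff₀ hc1'] at h1
    linarith
  have hN := hrn n hn hxr
  have hn16 : 16 ≤ n := (le_max_left _ _).trans hN
  have hn0 : (0 : ℝ) < n := by positivity
  have hna : 1 ≤ n * a := by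
    have h1 : (1 / a : ℝ) ≤ n :=
      (Nat.le_ceil _).trans (by exact_mod_cast (le_max_right _ _).trans hN)
    rwa [div_le_iff₀ ha_pos] at h1
  have hL := one_le_log_log hn16
  set L := Real.log (Real.log n) with hLdef
  have hnx : n * x ^ 2 = L := by
    rw [hx, Real.sq_sqrt (by positivity)]; field_simp
  obtain ⟨k, hkK, hka, hka2⟩ := exists_mem_Kfin ha_half hna
  obtain ⟨hk1, hk2⟩ := mem_Kfin_le (by omega) hkK
  have hkn : k ≤ n := hk2.trans (Nat.div_le_self _ _)
  obtain ⟨t, ⟨htM, htT⟩, htk⟩ : ∃ t ∈ Icc (M + 1) T, gaussTail t = k / n := by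
    have := intermediate_value_Icc' hTM continuous_gaussTail.continuousOn
    refine this ⟨hTa.trans ?_, ?_⟩
    · rw [le_div_iff₀ hn0]; linarith
    · rw [div_le_iff₀ hn0]; linarith
  set δ := D * x with hδ
  have hδ0 : 0 ≤ δ := by positivity
  have hnull : sampleMeasure n phiG {ω | spacing k ω > 2 * (t + δ)}
      ≤ ENNReal.ofReal (α / (Kfin n).card) := by
    refine (sampleMeasure_phiG_spacing_gt_le hk1 hkn (x := c₀ * δ) (by positivity) ?_).trans
      (ENNReal.ofReal_le_ofReal ?_)
    · have h1 := gaussTail_add_le (by linarith : 0 ≤ t) hδ0 (by linarith : t + δ ≤ T + 1)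
      rw [htk] at h1
      have h2 : (n : ℝ) * (gaussTail (t + δ) + c₀ * δ) ≤ n * (k / n) :=
        mul_le_mul_of_nonneg_left (by linarith) hn0.le
      rwa [mul_div_cancel₀ _ hn0.ne'] at h2
    · have hcD : c₀ * D = Real.log (4 / α) + 1 := by rw [hD]; field_simp
      have h1 : 2 * n * (c₀ * δ) ^ 2 = 2 * (Real.log (4 / α) + 1) ^ 2 * L := by
        rw [← hcD, ← hnx, hδ]; ring
      rw [h1]
      exact two_mul_exp_le_div_card_Kfin hn16 hα
  have hprob : IsProbabilityMeasure (sampleMeasure n phiG) := by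
    rw [← mixG_zero_zero 0]
    exact isProbabilityMeasure_sampleMeasure_mixG n ⟨le_rfl, zero_le_one⟩
  have hq : spacingQuantile n phiG (alphaN n phiG α) k ≤ 2 * (t + δ) :=
    spacingQuantile_le (by linarith)
      (hnull.trans (ENNReal.ofReal_le_ofReal (div_card_le_alphaN hα)))
  have hsub : (psiReject n phiG α)ᶜ ⊆ {ω | spacing k ω ≤ 2 * (t + δ)} := by
    intro ω hω
    by_contra hc
    exact hω ⟨k, hkK, hq.trans_lt (not_le.1 hc)⟩
  refine (measure_mono hsub).trans ((sampleMeasure_mixG_spacing_le_le hk1 hkn hε' hμ.le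
    (x := E * x) (B := T + 1 + M) (by positivity) (by linarith) (by linarith) ?_).trans
    (ENNReal.ofReal_le_ofReal ?_))
  · have h1 := gaussTail_add_ge (t := t) hδ0
    rw [htk] at h1
    have h2 : (n : ℝ) * (k / n) ≤
        n * (gaussTail (t + δ) + c₁ * (ε * (1 - ε) * (μ₂ - μ₁) ^ 2) - E * x) :=
      mul_le_mul_of_nonneg_left (by linarith) hn0.le
    rwa [mul_div_cancel₀ _ hn0.ne'] at h2
  · have h1 : 2 * n * (E * x) ^ 2 = 2 * E ^ 2 * L := by rw [← hnx]; ring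
    rw [h1]
    exact two_mul_exp_le ⟨hβ0, by linarith [hβ.2]⟩ hL
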